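/- arXiv:2505.18716 — 2 statements merged into one kernel-verified Lean document; each statement's English description precedes it below -/
import Mathlib

section
/- Let U ⊆ ℝ² be open, x: U → ℝ⁴ smooth, v: U → ℝ⁴ smooth, and u0 ∈ U such that ∂x/∂u1(u0), ∂x/∂u2(u0), v(u0) are linearly independent. Suppose there exist a linear map S: ℝ² → ℝ² and a linear form μ: ℝ² → ℝ such that ∂v/∂u_i(u0) = −dx(u0)(S e_i) + μ(e_i) v(u0) for i = 1,2. Define the line congruence F: U × ℝ → ℝ⁴ by F(u,t) = x(u) + t v(u). Then (u0, t0) is a singular (critical) point of F, i.e. the derivative dF(u0,t0): ℝ³ → ℝ⁴ is not injective, if and only if t0 ≠ 0 and 1/t0 is an eigenvalue of S. -/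
open Matrix

/-- The partial derivative of `f` in the `i`-th coordinate direction at `u`. -/
noncomputable def pder {E : Type*} [NormedAddCommGroup E] [NormedSpace ℝ E]
    (f : (Fin 2 → ℝ) → E) (i : Fin 2) (u : Fin 2 → ℝ) : E :=
  fderiv ℝ f u (Pi.single i 1)

/-- The linear algebra behind the focal points of a line congruence: if `B = -A ∘ S + μ ⊗ n`
and `A`, `n` are jointly injective, then `(w, s) ↦ A w + t • B w + s • n` fails to be injective
exactly when `t ≠ 0` and `1 / t` is an eigenvalue of `S`. -/
theorem not_injective_iff_hasEigenvalue {K V E : Type*} [Field K] [AddCommGroup V] [Module K V]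
    [AddCommGroup E] [Module K E] (A B : V →ₗ[K] E) (n : E) (S : V →ₗ[K] V) (μ : V →ₗ[K] K)
    (hind : ∀ w (c : K), A w + c • n = 0 → w = 0 ∧ c = 0)
    (hB : ∀ w, B w = -A (S w) + μ w • n) (t : K) (L : V × K →ₗ[K] E)
    (hL : ∀ w s, L (w, s) = A w + t • B w + s • n) :
    ¬ Function.Injective L ↔ t ≠ 0 ∧ Module.End.HasEigenvalue S (1 / t) := by
  have hL' (w : V) (s : K) : L (w, s) = A (w - t • S w) + (s + t * μ w) • n := by
    rw [hL, hB, map_sub, map_smul]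
    module
  rw [injective_iff_map_eq_zero]
  push Not
  constructor
  · rintro ⟨⟨w, s⟩, h0, hne⟩
    rw [hL'] at h0
    obtain ⟨hw, hs⟩ := hind _ _ h0
    have hw0 : w ≠ 0 := by
      rintro rfl
      exact hne (by simpa using hs)
    have ht : t ≠ 0 := by
      rintro rfl
      exact hw0 (by simpa using hw)
    refine ⟨ht, Module.End.hasEigenvalue_of_hasEigenvector (x := w)
      ⟨Module.End.mem_eigenspace_iff.2 ?_, hw0⟩⟩
    rw [one_div, eq_inv_smul_iff₀ ht, ← sub_eq_zero.1 hw]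
  · rintro ⟨ht, hS⟩
    obtain ⟨w, hw⟩ := hS.exists_hasEigenvector
    refine ⟨(w, -(t * μ w)), ?_, fun h => hw.2 (congrArg Prod.fst h)⟩
    rw [hL', hw.apply_eq_smul, smul_smul, mul_one_div_cancel ht]
    simp

/-- The derivative of the line congruence `(u, t) ↦ x u + t • v u`. -/
theorem fderiv_add_smul_apply {V E : Type*} [NormedAddCommGroup V] [NormedSpace ℝ V]
    [NormedAddCommGroup E] [NormedSpace ℝ E] {x v : V → E} {u : V}
    (hx : DifferentiableAt ℝ x u) (hv : DifferentiableAt ℝ v u) (t : ℝ) (w : V) (s : ℝ) :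
    fderiv ℝ (fun q : V × ℝ => x q.1 + q.2 • v q.1) (u, t) (w, s) =
      fderiv ℝ x u w + t • fderiv ℝ v u w + s • v u := by
  have h1 : HasFDerivAt (fun q : V × ℝ => x q.1) _ (u, t) :=
    HasFDerivAt.comp (u, t) hx.hasFDerivAt hasFDerivAt_fst
  have h2 : HasFDerivAt (fun q : V × ℝ => v q.1) _ (u, t) :=
    HasFDerivAt.comp (u, t) hv.hasFDerivAt hasFDerivAt_fst
  rw [(h1.fun_add (hasFDerivAt_snd.fun_smul h2)).fderiv]
  simp [add_assoc]

/-- The derivative of a function on the plane in terms of its partial derivatives. -/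
theorem fderiv_apply_eq_pder {E : Type*} [NormedAddCommGroup E] [NormedSpace ℝ E]
    (f : (Fin 2 → ℝ) → E) (u w : Fin 2 → ℝ) :
    fderiv ℝ f u w = w 0 • pder f 0 u + w 1 • pder f 1 u := by
  conv_lhs => rw [pi_eq_sum_univ' w]
  simp [Fin.sum_univ_two, pder, Pi.single]

/-- For a line congruence `F(u,t) = x(u) + t v(u)` whose director field `v` satisfies
`∂v/∂u_i(u0) = −dx(u0)(S e_i) + μ(e_i) v(u0)`, the point `(u0, t0)` is a critical point
of `F` (i.e. `dF(u0,t0)` is not injective) if and only if `t0 ≠ 0` and `1/t0` is an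
eigenvalue of the shape operator `S`. -/
theorem stmt11 (U : Set (Fin 2 → ℝ)) (hU : IsOpen U)
    (x v : (Fin 2 → ℝ) → (Fin 4 → ℝ))
    (hx : ContDiffOn ℝ (⊤ : ℕ∞) x U) (hv : ContDiffOn ℝ (⊤ : ℕ∞) v U)
    (u0 : Fin 2 → ℝ) (hu0 : u0 ∈ U)
    (hind : LinearIndependent ℝ ![pder x 0 u0, pder x 1 u0, v u0])
    (S : Fin 2 → Fin 2 → ℝ) (μ : Fin 2 → ℝ)
    (hdecv : ∀ i : Fin 2,
      pder v i u0 = -fderiv ℝ x u0 (Matrix.of S *ᵥ Pi.single i 1)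
        + (μ ⬝ᵥ Pi.single i 1) • v u0)
    (F : ((Fin 2 → ℝ) × ℝ) → (Fin 4 → ℝ))
    (hF : F = fun q => x q.1 + q.2 • v q.1)
    (t0 : ℝ) :
    ¬ Function.Injective ⇑(fderiv ℝ F (u0, t0)) ↔
      t0 ≠ 0 ∧ Module.End.HasEigenvalue (Matrix.of S).mulVecLin (1 / t0) := by
  subst hF
  have hxd : DifferentiableAt ℝ x u0 :=
    (hx.contDiffAt (hU.mem_nhds hu0)).differentiableAt (by simp)
  have hvd : DifferentiableAt ℝ v u0 :=
    (hv.contDiffAt (hU.mem_nhds hu0)).differentiableAt (by simp)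
  refine not_injective_iff_hasEigenvalue (fderiv ℝ x u0).toLinearMap (fderiv ℝ v u0).toLinearMap
    (v u0) (Matrix.of S).mulVecLin (dotProductBilin ℝ ℝ μ) ?_ ?_ t0
    (fderiv ℝ (fun q : (Fin 2 → ℝ) × ℝ => x q.1 + q.2 • v q.1) (u0, t0)).toLinearMap
    (fderiv_add_smul_apply hxd hvd t0)
  · intro w c h
    have h' := Fintype.linearIndependent_iff.1 hind ![w 0, w 1, c]
      (by simpa [Fin.sum_univ_three, fderiv_apply_eq_pder] using h)
    refine ⟨?_, h' 2⟩
    ext i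
    fin_cases i
    exacts [h' 0, h' 1]
  · intro w
    have hw : w = w 0 • Pi.single 0 1 + w 1 • Pi.single 1 1 := by
      ext i
      fin_cases i <;> simp
    change fderiv ℝ v u0 w = -fderiv ℝ x u0 (Matrix.of S *ᵥ w) + (μ ⬝ᵥ w) • v u0
    rw [fderiv_apply_eq_pder v, hdecv, hdecv]
    conv_rhs => rw [hw]
    simp only [mulVec_add, mulVec_smul, map_add, map_smul, dotProduct_add, dotProduct_smul,
      smul_eq_mul]
    module
end

section
/- Assume the decomposition hypotheses for the frame (ξ1, ξ2) along x, including the frame condition that ∂ξ_k/∂u_i has no ξ2-component, and let u0 ∈ U with (h2_{ij}(u0)) invertible. Fix (t0, l0) ∈ ℝ², set p = x(u0) + t0 ξ1(u0) + l0 ξ2(u0), and let s: U → ℝ be the affine distance function of p, i.e. the unique smooth function with x(u) − p = dx(u)(Z(u)) + δ(u) ξ1(u) + s(u) ξ2(u). Then u0 is a critical point of s, and the following are equivalent: (a) (u0, t0, l0) is a singular point of the plane congruence F(u,t,l) = x(u) + t ξ1(u) + l ξ2(u); (b) the Hessian matrix of s at u0 is degenerate; (c) det(Id − t0 S1(u0)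 − l0 S2(u0)) = 0. -/
open Matrix

section PartialDerivatives

variable {E : Type*} [NormedAddCommGroup E] [NormedSpace ℝ E]

lemma fderiv_eq_pder (f : (Fin 2 → ℝ) → E) (u v : Fin 2 → ℝ) :
    fderiv ℝ f u v = v 0 • pder f 0 u + v 1 • pder f 1 u := by
  have hv : v = v 0 • Pi.single 0 1 + v 1 • Pi.single 1 1 := by
    ext i; fin_cases i <;> simp
  conv_lhs => rw [hv]
  simp [pder]

lemma pder_congr {f g : (Fin 2 → ℝ) → E} {U : Set (Fin 2 → ℝ)} (hU : IsOpen U)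
    (h : ∀ u ∈ U, f u = g u) (i : Fin 2) {u : Fin 2 → ℝ} (hu : u ∈ U) :
    pder f i u = pder g i u := by
  have : f =ᶠ[nhds u] g := Filter.eventuallyEq_of_mem (hU.mem_nhds hu) h
  rw [pder, pder, this.fderiv_eq]

lemma pder_add {f g : (Fin 2 → ℝ) → E} {u : Fin 2 → ℝ} (hf : DifferentiableAt ℝ f u)
    (hg : DifferentiableAt ℝ g u) (i : Fin 2) :
    pder (fun w => f w + g w) i u = pder f i u + pder g i u := by
  simp [pder, fderiv_fun_add hf hg]

lemma pder_smul {c : (Fin 2 → ℝ) → ℝ} {f : (Fin 2 → ℝ) → E} {u : Fin 2 → ℝ}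
    (hc : DifferentiableAt ℝ c u) (hf : DifferentiableAt ℝ f u) (i : Fin 2) :
    pder (fun w => c w • f w) i u = c u • pder f i u + pder c i u • f u := by
  simp [pder, fderiv_fun_smul hc hf]

lemma differentiableAt_pder {f : (Fin 2 → ℝ) → E} {U : Set (Fin 2 → ℝ)} (hU : IsOpen U)
    (hf : ContDiffOn ℝ (⊤ : ℕ∞) f U) (i : Fin 2) {u : Fin 2 → ℝ} (hu : u ∈ U) :
    DifferentiableAt ℝ (pder f i) u := by
  have h : ContDiffOn ℝ 1 (fderiv ℝ f) U := hf.fderiv_of_isOpen hU (by norm_cast)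
  have := (h.differentiableOn one_ne_zero).differentiableAt (hU.mem_nhds hu)
  exact this.clm_apply (differentiableAt_const _)

end PartialDerivatives

lemma coeff_eq_of_linearIndependent {E : Type*} [AddCommGroup E] [Module ℝ E] {a b c d : E}
    (h : LinearIndependent ℝ ![a, b, c, d]) {p q r s p' q' r' s' : ℝ}
    (he : p • a + q • b + r • c + s • d = p' • a + q' • b + r' • c + s' • d) :
    p = p' ∧ q = q' ∧ r = r' ∧ s = s' := by
  have h' := Fintype.linearIndependent_iff.1 h ![p - p', q - q', r - r', s - s'] (by
    simp only [Fin.sum_univ_four, Matrix.cons_val]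
    linear_combination (norm := module) he)
  refine ⟨?_, ?_, ?_, ?_⟩
  · simpa [sub_eq_zero] using h' 0
  · simpa [sub_eq_zero] using h' 1
  · simpa [sub_eq_zero] using h' 2
  · simpa [sub_eq_zero] using h' 3

/-- Under the decomposition hypotheses for the frame `(ξ1, ξ2)` along `x`, with
`(h2_{ij}(u0))` invertible, set `p = x(u0) + t0 ξ1(u0) + l0 ξ2(u0)` and let `s` be the
affine distance function of `p`. Then `u0` is a critical point of `s`, and the following
are equivalent: `(u0,t0,l0)` is a singular point of the plane congruence
`F(u,t,l) = x(u) + t ξ1(u) + l ξ2(u)`; the Hessian of `s` at `u0` is degenerate;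
`det(Id − t0 S1(u0) − l0 S2(u0)) = 0`. -/
theorem stmt14 (U : Set (Fin 2 → ℝ)) (hU : IsOpen U)
    (x ξ1 ξ2 : (Fin 2 → ℝ) → (Fin 4 → ℝ))
    (hx : ContDiffOn ℝ (⊤ : ℕ∞) x U) (hξ1 : ContDiffOn ℝ (⊤ : ℕ∞) ξ1 U)
    (hξ2 : ContDiffOn ℝ (⊤ : ℕ∞) ξ2 U)
    (hind : ∀ u ∈ U, LinearIndependent ℝ ![pder x 0 u, pder x 1 u, ξ1 u, ξ2 u])
    (Γ : (Fin 2 → ℝ) → Fin 2 → Fin 2 → (Fin 2 → ℝ))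
    (h1 h2 : (Fin 2 → ℝ) → Fin 2 → Fin 2 → ℝ)
    (hΓ : ContDiffOn ℝ (⊤ : ℕ∞) Γ U)
    (hh1 : ContDiffOn ℝ (⊤ : ℕ∞) h1 U) (hh2 : ContDiffOn ℝ (⊤ : ℕ∞) h2 U)
    (hdec2 : ∀ u ∈ U, ∀ i j : Fin 2,
      pder (pder x j) i u =
        fderiv ℝ x u (Γ u i j) + h1 u i j • ξ1 u + h2 u i j • ξ2 u)
    (S1 S2 : (Fin 2 → ℝ) → Fin 2 → Fin 2 → ℝ)
    (τ1 τ2 : (Fin 2 → ℝ) → (Fin 2 → ℝ))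
    (hS1 : ContDiffOn ℝ (⊤ : ℕ∞) S1 U) (hS2 : ContDiffOn ℝ (⊤ : ℕ∞) S2 U)
    (hτ1 : ContDiffOn ℝ (⊤ : ℕ∞) τ1 U) (hτ2 : ContDiffOn ℝ (⊤ : ℕ∞) τ2 U)
    (hdecξ1 : ∀ u ∈ U, ∀ i : Fin 2,
      pder ξ1 i u = -fderiv ℝ x u (Matrix.of (S1 u) *ᵥ Pi.single i 1)
        + (τ1 u ⬝ᵥ Pi.single i 1) • ξ1 u)
    (hdecξ2 : ∀ u ∈ U, ∀ i : Fin 2,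
      pder ξ2 i u = -fderiv ℝ x u (Matrix.of (S2 u) *ᵥ Pi.single i 1)
        + (τ2 u ⬝ᵥ Pi.single i 1) • ξ1 u)
    (u0 : Fin 2 → ℝ) (hu0 : u0 ∈ U)
    (hinv : IsUnit (Matrix.of (h2 u0)))
    (t0 l0 : ℝ) (p : Fin 4 → ℝ)
    (hp : p = x u0 + t0 • ξ1 u0 + l0 • ξ2 u0)
    (Z : (Fin 2 → ℝ) → (Fin 2 → ℝ)) (δp s : (Fin 2 → ℝ) → ℝ)
    (hZ : ContDiffOn ℝ (⊤ : ℕ∞) Z U) (hδp : ContDiffOn ℝ (⊤ : ℕ∞) δp U)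
    (hs : ContDiffOn ℝ (⊤ : ℕ∞) s U)
    (hdist : ∀ u ∈ U, x u - p = fderiv ℝ x u (Z u) + δp u • ξ1 u + s u • ξ2 u)
    (F : ((Fin 2 → ℝ) × ℝ × ℝ) → (Fin 4 → ℝ))
    (hF : F = fun q => x q.1 + q.2.1 • ξ1 q.1 + q.2.2 • ξ2 q.1) :
    (∀ i : Fin 2, fderiv ℝ s u0 (Pi.single i 1) = 0) ∧
    (¬ Function.Bijective ⇑(fderiv ℝ F (u0, t0, l0)) ↔
      (Matrix.of fun i j : Fin 2 => pder (pder s j) i u0).det = 0) ∧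
    ((Matrix.of fun i j : Fin 2 => pder (pder s j) i u0).det = 0 ↔
      (1 - t0 • Matrix.of (S1 u0) - l0 • Matrix.of (S2 u0)).det = 0) := by
  have dif : ∀ {E : Type} [NormedAddCommGroup E] [NormedSpace ℝ E] {f : (Fin 2 → ℝ) → E},
      ContDiffOn ℝ (⊤ : ℕ∞) f U → ∀ u ∈ U, DifferentiableAt ℝ f u := fun hf u hu =>
    (hf.differentiableOn (by simp)).differentiableAt (hU.mem_nhds hu)
  have dZ : ∀ u ∈ U, ∀ j, DifferentiableAt ℝ (fun w => Z w j) u := fun u hu j =>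
    differentiableAt_pi.1 (dif hZ u hu) j
  have dh2 : ∀ u ∈ U, ∀ i j, DifferentiableAt ℝ (fun w => h2 w i j) u := fun u hu i j =>
    differentiableAt_pi.1 (differentiableAt_pi.1 (dif hh2 u hu) i) j
  -- The coefficients of `x - p` at `u0`.
  have hval : Z u0 0 = 0 ∧ Z u0 1 = 0 ∧ δp u0 = -t0 ∧ s u0 = -l0 := by
    apply coeff_eq_of_linearIndependent (hind u0 hu0)
    have h := hdist u0 hu0
    rw [fderiv_eq_pder, hp] at h
    rw [← h]
    module
  obtain ⟨hZ0, hZ1, hδ0, hs0⟩ := hval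
  -- Differentiate the decomposition of `x - p` and compare coefficients in the frame.
  have key : ∀ u ∈ U, ∀ i,
      (∀ k, (Pi.single i 1 : Fin 2 → ℝ) k = pder (fun w => Z w k) i u
        + Z u 0 * Γ u i 0 k + Z u 1 * Γ u i 1 k - δp u * S1 u k i - s u * S2 u k i) ∧
      pder s i u = -(Z u 0 * h2 u i 0 + Z u 1 * h2 u i 1) := by
    intro u hu i
    have e1 : pder x i u = pder (fun w => (((Z w 0 • pder x 0 w + Z w 1 • pder x 1 w)
        + δp w • ξ1 w) + s w • ξ2 w) + p) i u := by
      refine pder_congr hU (fun w hw => ?_) i hu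
      rw [← fderiv_eq_pder, ← hdist w hw]
      module
    have dx := differentiableAt_pder hU hx (u := u)
    have d0 := (dZ u hu 0).fun_smul (dx 0 hu)
    have d1 := (dZ u hu 1).fun_smul (dx 1 hu)
    have d2 := (dif hδp u hu).fun_smul (dif hξ1 u hu)
    have d3 := (dif hs u hu).fun_smul (dif hξ2 u hu)
    rw [pder_add (((d0.fun_add d1).fun_add d2).fun_add d3) (differentiableAt_const p),
      pder_add ((d0.fun_add d1).fun_add d2) d3, pder_add (d0.fun_add d1) d2, pder_add d0 d1,
      pder_smul (dZ u hu 0) (dx 0 hu), pder_smul (dZ u hu 1) (dx 1 hu),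
      pder_smul (dif hδp u hu) (dif hξ1 u hu), pder_smul (dif hs u hu) (dif hξ2 u hu),
      hdec2 u hu, hdec2 u hu, hdecξ1 u hu, hdecξ2 u hu] at e1
    simp only [fderiv_eq_pder] at e1
    have hc : pder (fun _ : Fin 2 → ℝ => p) i u = 0 := by simp [pder]
    have hl : pder x i u = (Pi.single i 1 : Fin 2 → ℝ) 0 • pder x 0 u
        + (Pi.single i 1 : Fin 2 → ℝ) 1 • pder x 1 u := fderiv_eq_pder x u _
    rw [hc, hl] at e1
    simp only [Matrix.mulVec_single_one, Matrix.col_apply, Matrix.of_apply] at e1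
    obtain ⟨c0, c1, -, c3⟩ := coeff_eq_of_linearIndependent (hind u hu)
      (p := (Pi.single i 1 : Fin 2 → ℝ) 0) (q := (Pi.single i 1 : Fin 2 → ℝ) 1) (r := 0) (s := 0)
      (p' := pder (fun w => Z w 0) i u
        + Z u 0 * Γ u i 0 0 + Z u 1 * Γ u i 1 0 - δp u * S1 u 0 i - s u * S2 u 0 i)
      (q' := pder (fun w => Z w 1) i u
        + Z u 0 * Γ u i 0 1 + Z u 1 * Γ u i 1 1 - δp u * S1 u 1 i - s u * S2 u 1 i)
      (r' := Z u 0 * h1 u i 0 + Z u 1 * h1 u i 1 + pder δp i u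
        + δp u * (τ1 u ⬝ᵥ Pi.single i 1) + s u * (τ2 u ⬝ᵥ Pi.single i 1))
      (s' := Z u 0 * h2 u i 0 + Z u 1 * h2 u i 1 + pder s i u)
      (by linear_combination (norm := module) e1)
    refine ⟨fun k => ?_, by linarith⟩
    fin_cases k
    · exact c0
    · exact c1
  set M : Matrix (Fin 2) (Fin 2) ℝ := 1 - t0 • Matrix.of (S1 u0) - l0 • Matrix.of (S2 u0) with hM
  have dZM : ∀ i k, pder (fun w => Z w k) i u0 = M k i := by
    intro i k
    have h := (key u0 hu0 i).1 k
    rw [hZ0, hZ1, hδ0, hs0, Pi.single_apply] at h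
    simp only [hM, Matrix.sub_apply, Matrix.smul_apply, Matrix.of_apply, Matrix.one_apply,
      smul_eq_mul]
    linarith
  have hess : ∀ i j, pder (pder s j) i u0 = -(h2 u0 j 0 * M 0 i + h2 u0 j 1 * M 1 i) := by
    intro i j
    have e : pder (pder s j) i u0
        = pder (fun w => Z w 0 • (-h2 w j 0) + Z w 1 • (-h2 w j 1)) i u0 := by
      refine pder_congr hU (fun w hw => ?_) i hu0
      rw [(key w hw j).2]
      simp only [smul_eq_mul]
      ring
    have g0 := (dh2 u0 hu0 j 0).fun_neg
    have g1 := (dh2 u0 hu0 j 1).fun_neg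
    rw [e, pder_add ((dZ u0 hu0 0).fun_smul g0) ((dZ u0 hu0 1).fun_smul g1),
      pder_smul (dZ u0 hu0 0) g0, pder_smul (dZ u0 hu0 1) g1, hZ0, hZ1, dZM, dZM]
    simp only [smul_eq_mul]
    ring
  have hdet : (Matrix.of fun i j : Fin 2 => pder (pder s j) i u0).det = 0 ↔ M.det = 0 := by
    have e : (Matrix.of fun i j : Fin 2 => pder (pder s j) i u0).det
        = (Matrix.of (h2 u0)).det * M.det := by
      simp only [Matrix.det_fin_two, Matrix.of_apply, hess]
      ring
    have hne : (Matrix.of (h2 u0)).det ≠ 0 :=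
      ((Matrix.isUnit_iff_isUnit_det _).1 hinv).ne_zero
    rw [e, mul_eq_zero, or_iff_right hne]
  -- The differential of the plane congruence in the frame.
  have dF : ∀ v a b, fderiv ℝ F (u0, t0, l0) (v, a, b) =
      (M *ᵥ v) 0 • pder x 0 u0 + (M *ᵥ v) 1 • pder x 1 u0
        + (t0 * (τ1 u0 ⬝ᵥ v) + l0 * (τ2 u0 ⬝ᵥ v) + a) • ξ1 u0 + b • ξ2 u0 := by
    intro v a b
    have f1 : HasFDerivAt (fun q : (Fin 2 → ℝ) × ℝ × ℝ => q.1)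
        (ContinuousLinearMap.fst ℝ (Fin 2 → ℝ) (ℝ × ℝ)) (u0, t0, l0) := hasFDerivAt_fst
    have f2 : HasFDerivAt (fun q : (Fin 2 → ℝ) × ℝ × ℝ => q.2)
        (ContinuousLinearMap.snd ℝ (Fin 2 → ℝ) (ℝ × ℝ)) (u0, t0, l0) := hasFDerivAt_snd
    have gx := HasFDerivAt.comp (u0, t0, l0) (g := x) (dif hx u0 hu0).hasFDerivAt f1
    have g1 := HasFDerivAt.comp (u0, t0, l0) (g := ξ1) (dif hξ1 u0 hu0).hasFDerivAt f1
    have g2 := HasFDerivAt.comp (u0, t0, l0) (g := ξ2) (dif hξ2 u0 hu0).hasFDerivAt f1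
    have hFd := (gx.add (f2.fst.smul g1)).add (f2.snd.smul g2)
    subst hF
    refine (DFunLike.congr_fun hFd.fderiv (v, a, b)).trans ?_
    simp [fderiv_eq_pder]
    rw [hdecξ1 u0 hu0, hdecξ1 u0 hu0, hdecξ2 u0 hu0, hdecξ2 u0 hu0]
    simp only [fderiv_eq_pder, Matrix.mulVec_single_one, Matrix.col_apply, Matrix.of_apply, hM,
      dotProduct, Fin.sum_univ_two, Matrix.sub_apply, Matrix.smul_apply,
      Matrix.one_apply, smul_eq_mul]
    simp
    module
  have hsing : ¬ Function.Bijective ⇑(fderiv ℝ F (u0, t0, l0)) ↔ M.det = 0 := by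
    have hbij : Function.Bijective ⇑(fderiv ℝ F (u0, t0, l0)) ↔
        Function.Injective ⇑(fderiv ℝ F (u0, t0, l0)) :=
      ⟨fun h => h.1, fun h => ⟨h, (LinearMap.injective_iff_surjective_of_finrank_eq_finrank
        (f := (fderiv ℝ F (u0, t0, l0)).toLinearMap) (by simp)).1 h⟩⟩
    rw [hbij, ← Matrix.exists_mulVec_eq_zero_iff, injective_iff_map_eq_zero]
    push Not
    constructor
    · rintro ⟨⟨v, a, b⟩, h0, hne⟩
      rw [dF] at h0
      obtain ⟨c0, c1, c2, c3⟩ := coeff_eq_of_linearIndependent (hind u0 hu0)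
        (p' := 0) (q' := 0) (r' := 0) (s' := 0) (h0.trans (by simp))
      refine ⟨v, fun hv => hne ?_, ?_⟩
      · subst hv c3
        simpa using c2
      · ext k
        fin_cases k
        · exact c0
        · exact c1
    · rintro ⟨v, hv, hMv⟩
      refine ⟨(v, -(t0 * (τ1 u0 ⬝ᵥ v) + l0 * (τ2 u0 ⬝ᵥ v)), 0), ?_, fun h => hv ?_⟩
      · rw [dF, hMv]
        simp
      · exact congrArg Prod.fst h
  refine ⟨fun i => ?_, hsing.trans hdet.symm, hdet⟩
  have h := (key u0 hu0 i).2
  rw [hZ0, hZ1] at h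
  simpa [pder] using h
end
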